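/- arXiv:1712.01906 — 2 statements merged into one kernel-verified Lean document; each statement's English description precedes it below -/
import Mathlib

section
/- Let K : ℝ^d × Ω → ℝ be such that for every ω ∈ Ω the function K(·, ω) is convex and differentiable with L₀-Lipschitz continuous gradient (L₀ > 0, uniform in ω). Let f : ℝ^d → ℝ be convex and differentiable with ∇f(y) = E[∇_x K(y, ξ)] for every y (the expectation existing), with nonempty minimizer set S, and assume f is μ-restricted strongly convex (μ > 0): f(y) - f(P_S y) ≥ (μ/2)‖y - P_S y‖² for all y ∈ ℝ^d. Then for every x ∈ ℝ^d, writing x̄ = P_S x, E[‖∇_x K(x, ξ)‖²] ≤ (4L₀/μ)‖∇f(x)‖² + 2·E[‖∇_x K(x̄, ξ)‖²]. In particular, if E[‖∇_x K(x̄, ξ)‖²] ≤ β² < ∞, the weak growth condition holds at x with M = 4L₀/μ and σ² = 2β². -/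
open MeasureTheory

lemma aux_line {E : Type*} [NormedAddCommGroup E] [InnerProductSpace ℝ E] [CompleteSpace E]
    {h : E → ℝ} (hd : Differentiable ℝ h) (y v : E) (t : ℝ) :
    HasDerivAt (fun s : ℝ => h (y + s • v)) (inner ℝ (gradient h (y + t • v)) v) t := by
  have h1 := (hd (y + t • v)).hasGradientAt.hasFDerivAt
  have h2 : HasDerivAt (fun s : ℝ => y + s • v) v t := by
    simpa using ((hasDerivAt_id t).smul_const v).const_add y
  have h3 := h1.comp_hasDerivAt t h2
  exact h3.congr_deriv (by simp)

lemma aux_grad_ineq {E : Type*} [NormedAddCommGroup E] [InnerProductSpace ℝ E] [CompleteSpace E]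
    {h : E → ℝ} (hc : ConvexOn ℝ Set.univ h) (hd : Differentiable ℝ h) (y z : E) :
    h y + inner ℝ (gradient h y) (z - y) ≤ h z := by
  have hc' : ConvexOn ℝ Set.univ (fun s : ℝ => h (y + s • (z - y))) := by
    have := hc.comp_affineMap (AffineMap.lineMap y z)
    simpa [Function.comp_def, AffineMap.lineMap_apply, add_comm] using this
  have h1 := aux_line hd y (z - y) 0
  have h2 := hc'.le_slope_of_hasDerivAt (Set.mem_univ 0) (Set.mem_univ 1) one_pos h1
  simp [slope_def_field] at h2
  simp
  linarith

lemma aux_descent {E : Type*} [NormedAddCommGroup E] [InnerProductSpace ℝ E] [CompleteSpace E]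
    {h : E → ℝ} (hd : Differentiable ℝ h) {L : ℝ}
    (hL : ∀ y z, ‖gradient h y - gradient h z‖ ≤ L * ‖y - z‖) (y z : E) :
    h z ≤ h y + inner ℝ (gradient h y) (z - y) + L / 2 * ‖z - y‖ ^ 2 := by
  set v := z - y with hv
  let φ : ℝ → ℝ := fun t => h (y + t • v) - t * inner ℝ (gradient h y) v - L / 2 * ‖v‖ ^ 2 * t ^ 2
  have hφ : ∀ t, HasDerivAt φ (inner ℝ (gradient h (y + t • v)) v - inner ℝ (gradient h y) v
      - L * ‖v‖ ^ 2 * t) t := by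
    intro t
    have h1 := ((aux_line hd y v t).sub
      ((hasDerivAt_id t).mul_const (inner ℝ (gradient h y) v))).sub
      (((hasDerivAt_id t).pow 2).const_mul (L / 2 * ‖v‖ ^ 2))
    refine h1.congr_deriv ?_
    simp
    ring
  have hanti : AntitoneOn φ (Set.Icc 0 1) := by
    apply antitoneOn_of_deriv_nonpos (convex_Icc 0 1)
    · exact fun t _ => (hφ t).continuousAt.continuousWithinAt
    · exact fun t _ => (hφ t).differentiableAt.differentiableWithinAt
    · intro t ht
      rw [interior_Icc] at ht
      rw [(hφ t).deriv, ← inner_sub_left]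
      have h1 := real_inner_le_norm (gradient h (y + t • v) - gradient h y) v
      have h2 := hL (y + t • v) y
      rw [add_sub_cancel_left, norm_smul, Real.norm_of_nonneg ht.1.le] at h2
      have h3 := mul_le_mul_of_nonneg_right h2 (norm_nonneg v)
      nlinarith
  have := hanti (Set.left_mem_Icc.2 zero_le_one) (Set.right_mem_Icc.2 zero_le_one) zero_le_one
  simp [φ] at this
  have e : y + v = z := by simp [hv]
  rw [e] at this
  simp
  linarith

lemma aux_coc1 {E : Type*} [NormedAddCommGroup E] [InnerProductSpace ℝ E] [CompleteSpace E]
    {h : E → ℝ} (hc : ConvexOn ℝ Set.univ h) (hd : Differentiable ℝ h) {L : ℝ} (hL0 : 0 < L)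
    (hL : ∀ y z, ‖gradient h y - gradient h z‖ ≤ L * ‖y - z‖) (x y : E) :
    h x + inner ℝ (gradient h x) (y - x) + 1 / (2 * L) * ‖gradient h y - gradient h x‖ ^ 2
      ≤ h y := by
  set w := gradient h y - gradient h x with hw
  have h1 := aux_grad_ineq hc hd x (y - (1 / L) • w)
  have h2 := aux_descent hd hL y (y - (1 / L) • w)
  have e1 : y - (1 / L) • w - x = (y - x) - (1 / L) • w := by abel
  have e2 : y - (1 / L) • w - y = - ((1 / L) • w) := by abel
  rw [e1, inner_sub_right, inner_smul_right] at h1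
  rw [e2, norm_neg, inner_neg_right, inner_smul_right, norm_smul, mul_pow,
    Real.norm_of_nonneg (by positivity)] at h2
  have h3 : inner ℝ (gradient h y) w - inner ℝ (gradient h x) w = ‖w‖ ^ 2 := by
    rw [← inner_sub_left, ← hw, real_inner_self_eq_norm_sq]
  have h4 : L / 2 * ((1 / L) ^ 2 * ‖w‖ ^ 2) = 1 / (2 * L) * ‖w‖ ^ 2 := by field_simp
  have h5 : 1 / L * inner ℝ (gradient h y) w - 1 / L * inner ℝ (gradient h x) w
      = 2 * (1 / (2 * L) * ‖w‖ ^ 2) := by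
    rw [← mul_sub, h3]; field_simp
  linarith

lemma aux_coc {E : Type*} [NormedAddCommGroup E] [InnerProductSpace ℝ E] [CompleteSpace E]
    {h : E → ℝ} (hc : ConvexOn ℝ Set.univ h) (hd : Differentiable ℝ h) {L : ℝ} (hL0 : 0 < L)
    (hL : ∀ y z, ‖gradient h y - gradient h z‖ ≤ L * ‖y - z‖) (x y : E) :
    ‖gradient h x - gradient h y‖ ^ 2
      ≤ L * inner ℝ (gradient h x - gradient h y) (x - y) := by
  have h1 := aux_coc1 hc hd hL0 hL x y
  have h2 := aux_coc1 hc hd hL0 hL y x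
  rw [norm_sub_rev, ← neg_sub x y, inner_neg_right] at h1
  rw [inner_sub_left]
  have h3 : 2 * (1 / (2 * L) * ‖gradient h x - gradient h y‖ ^ 2)
      ≤ inner ℝ (gradient h x) (x - y) - inner ℝ (gradient h y) (x - y) := by linarith
  have h4 := mul_le_mul_of_nonneg_left h3 hL0.le
  have h5 : L * (2 * (1 / (2 * L) * ‖gradient h x - gradient h y‖ ^ 2))
    = ‖gradient h x - gradient h y‖ ^ 2 := by field_simp
  linarith

/-- Example 1: for a stochastic gradient with uniformly `L₀`-Lipschitz sample
gradients and a `μ`-restricted strongly convex objective, the second moment of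
the stochastic gradient at `x` is bounded by `(4L₀/μ)‖∇f(x)‖²` plus twice its
second moment at the projection `x̄` of `x` onto the minimizers. -/
theorem stmt_3 {d : ℕ} {Ω : Type*} [MeasurableSpace Ω] (P : Measure Ω)
    [IsProbabilityMeasure P]
    (K : EuclideanSpace ℝ (Fin d) → Ω → ℝ)
    (hKconv : ∀ a, ConvexOn ℝ Set.univ (fun y => K y a))
    (hKdiff : ∀ a, Differentiable ℝ (fun y => K y a))
    (L0 : ℝ) (hL0 : 0 < L0)
    (hKLip : ∀ a y z,
      ‖gradient (fun u => K u a) y - gradient (fun u => K u a) z‖ ≤ L0 * ‖y - z‖)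
    (f : EuclideanSpace ℝ (Fin d) → ℝ) (hfconv : ConvexOn ℝ Set.univ f)
    (hfdiff : Differentiable ℝ f)
    (hint : ∀ y, Integrable (fun a => gradient (fun u => K u a) y) P)
    (hgrad : ∀ y, gradient f y = ∫ a, gradient (fun u => K u a) y ∂P)
    (S : Set (EuclideanSpace ℝ (Fin d))) (hS : S = {y | ∀ z, f y ≤ f z})
    (hSne : S.Nonempty)
    (projS : EuclideanSpace ℝ (Fin d) → EuclideanSpace ℝ (Fin d))
    (hprojS : ∀ y, projS y ∈ S ∧ ∀ z ∈ S, ‖y - projS y‖ ≤ ‖y - z‖)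
    (μ : ℝ) (hμ : 0 < μ)
    (hrsc : ∀ y, f y - f (projS y) ≥ μ / 2 * ‖y - projS y‖ ^ 2)
    (x : EuclideanSpace ℝ (Fin d))
    (hL2x : Integrable (fun a => ‖gradient (fun u => K u a) x‖ ^ 2) P)
    (hL2xbar : Integrable (fun a => ‖gradient (fun u => K u a) (projS x)‖ ^ 2) P) :
    ∫ a, ‖gradient (fun u => K u a) x‖ ^ 2 ∂P ≤
      (4 * L0 / μ) * ‖gradient f x‖ ^ 2 +
        2 * ∫ a, ‖gradient (fun u => K u a) (projS x)‖ ^ 2 ∂P := by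
  set xb := projS x with hxb
  have hmin : ∀ z, f xb ≤ f z := by
    have := (hprojS x).1
    rw [hS] at this
    exact this
  have hg0 : gradient f xb = 0 := by
    have h1 : IsLocalMin f xb := Filter.Eventually.of_forall hmin
    simp [gradient, h1.fderiv_eq_zero]
  have hpt : ∀ a, ‖gradient (fun u => K u a) x‖ ^ 2 ≤
      2 * L0 * inner ℝ (x - xb) (gradient (fun u => K u a) x - gradient (fun u => K u a) xb)
      + 2 * ‖gradient (fun u => K u a) xb‖ ^ 2 := by
    intro a
    have h1 := aux_coc (hKconv a) (hKdiff a) hL0 (hKLip a) x xb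
    rw [real_inner_comm] at h1
    set p := gradient (fun u => K u a) x
    set q := gradient (fun u => K u a) xb
    have h2 : ‖p‖ ≤ ‖p - q‖ + ‖q‖ := by simpa using norm_add_le (p - q) q
    have h3 := norm_nonneg p
    nlinarith [sq_nonneg (‖p - q‖ - ‖q‖)]
  have hi := (hint x).sub (hint xb)
  have hi2 : Integrable (fun a => inner ℝ (x - xb)
      (gradient (fun u => K u a) x - gradient (fun u => K u a) xb)) P := hi.const_inner (x - xb)
  have h1 := integral_mono hL2x ((hi2.const_mul (2 * L0)).add (hL2xbar.const_mul 2)) hpt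
  have h2 : ∫ a, inner ℝ (x - xb)
      (gradient (fun u => K u a) x - gradient (fun u => K u a) xb) ∂P
      = inner ℝ (x - xb) (gradient f x) := by
    have := integral_inner (𝕜 := ℝ) hi (x - xb)
    simp only [Pi.sub_apply] at this
    rw [this, integral_sub (hint x) (hint xb), ← hgrad, ← hgrad, hg0, sub_zero]
  simp only [Pi.add_apply] at h1
  rw [integral_add (hi2.const_mul (2 * L0)) (hL2xbar.const_mul 2), integral_const_mul,
    integral_const_mul, h2] at h1
  refine h1.trans (add_le_add_left ?_ _)
  have h3 := real_inner_le_norm (x - xb) (gradient f x)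
  have h4 := aux_grad_ineq hfconv hfdiff x xb
  rw [← neg_sub x xb, inner_neg_right, real_inner_comm] at h4
  have h5 := hrsc x
  rw [← hxb] at h5
  have hn := norm_nonneg (x - xb)
  have hm := norm_nonneg (gradient f x)
  have h6 : μ / 2 * ‖x - xb‖ ≤ ‖gradient f x‖ := by
    rcases hn.eq_or_lt with h0 | h0
    · rw [← h0]; simpa using hm
    · refine le_of_mul_le_mul_right ?_ h0
      nlinarith
  have h7 : inner ℝ (x - xb) (gradient f x) ≤ 2 / μ * ‖gradient f x‖ ^ 2 := by
    have : ‖x - xb‖ ≤ 2 / μ * ‖gradient f x‖ := by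
      rw [div_mul_eq_mul_div, le_div_iff₀ hμ]; linarith
    nlinarith
  calc 2 * L0 * inner ℝ (x - xb) (gradient f x)
      ≤ 2 * L0 * (2 / μ * ‖gradient f x‖ ^ 2) := by gcongr
    _ = 4 * L0 / μ * ‖gradient f x‖ ^ 2 := by ring
end

section
/- Let ν be a probability measure on a measurable space Ω₀, let C ⊆ ℝ^d be a nonempty closed convex set, let f : ℝ^d → ℝ be convex and differentiable with L-Lipschitz continuous gradient (L > 0), with finite infimum f* = inf_{y ∈ ℝ^d} f(y), and suppose S = argmin_{y ∈ C} f(y) is nonempty. Assume f is μ-restricted strongly convex on C: f(y) - f(P_S y) ≥ (μ/2)‖y - P_S y‖² for all y ∈ C, with 0 < μ < 4LM. Let h : ℝ^d × Ω₀ → ℝ^d be (jointly) measurable with, for every x ∈ C: ∫ h(x, ω) dν(ω) = ∇f(x) and ∫ ‖h(x, ω)‖² dν(ω) ≤ M‖∇f(x)‖² + σ² (M > 0, σ ∈ ℝ). Let 0 < γ ≤ 1/(2LM), ρ = γμ(1 - γLM), σ₁² = σ² + 2LM(min_{y ∈ C} f(y) - f*). Fix x₀ ∈ C and define X₀ = x₀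 and X_{t+1}(ω₀, …, ω_t) = P_C(X_t(ω₀, …, ω_{t-1}) - γ·h(X_t(ω₀, …, ω_{t-1}), ω_t)). Then for every t ≥ 0, ∫ ‖X_t - P_S X_t‖² d(ν^{⊗t}) ≤ (1 - ρ)^t ‖x₀ - P_S x₀‖² + γ²σ₁²/ρ; i.e., the projected stochastic gradient method with constant step-size converges linearly to a noise-dominated region of squared radius proportional to γ²σ₁². -/
open MeasureTheory

section helpers

variable {d : ℕ}

local notation "E" => EuclideanSpace ℝ (Fin d)

theorem aux_line_deriv (f : E → ℝ) (hfdiff : Differentiable ℝ f) (x v : E) (t : ℝ) :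
    HasDerivAt (fun t : ℝ => f (x + t • v)) (inner ℝ (gradient f (x + t • v)) v) t := by
  have h1 : HasFDerivAt f (InnerProductSpace.toDual ℝ E (gradient f (x + t • v))) (x + t • v) :=
    ((hfdiff (x + t • v)).hasGradientAt).hasFDerivAt
  have h2 : HasDerivAt (fun t : ℝ => x + t • v) v t := by
    simpa using ((hasDerivAt_id t).smul_const v).const_add x
  have h3 := h1.comp_hasDerivAt t h2
  rw [InnerProductSpace.toDual_apply_apply] at h3
  exact h3

theorem aux_convex (f : E → ℝ) (hfconv : ConvexOn ℝ Set.univ f) (hfdiff : Differentiable ℝ f)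
    (x p : E) : f x - f p ≤ inner ℝ (gradient f x) (x - p) := by
  have hc : ConvexOn ℝ Set.univ (fun t : ℝ => f (x + t • (p - x))) := by
    have := hfconv.comp_affineMap (AffineMap.lineMap x p : ℝ →ᵃ[ℝ] E)
    have he : (fun t : ℝ => f (x + t • (p - x))) = f ∘ (AffineMap.lineMap x p : ℝ →ᵃ[ℝ] E) := by
      funext t
      simp [AffineMap.lineMap_apply, add_comm]
    rw [he]
    exact this
  have hd := aux_line_deriv f hfdiff x (p - x) 0
  have := hc.le_slope_of_hasDerivAt (Set.mem_univ 0) (Set.mem_univ 1) one_pos hd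
  simp only [slope_def_field, zero_smul, one_smul, add_zero, sub_zero, div_one,
    add_sub_cancel] at this
  have h2 : inner ℝ (gradient f x) (x - p) = - inner ℝ (gradient f x) (p - x) := by
    rw [← inner_neg_right, neg_sub]
  linarith

theorem aux_descent_s14 (f : E → ℝ) (hfdiff : Differentiable ℝ f) (L : ℝ)
    (hLip : ∀ y z, ‖gradient f y - gradient f z‖ ≤ L * ‖y - z‖) (x v : E) :
    f (x + v) ≤ f x + inner ℝ (gradient f x) v + L / 2 * ‖v‖ ^ 2 := by
  have hd : ∀ t : ℝ, HasDerivAt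
      (fun t : ℝ => f (x + t • v) - t * inner ℝ (gradient f x) v - L / 2 * ‖v‖ ^ 2 * t ^ 2)
      (inner ℝ (gradient f (x + t • v)) v - inner ℝ (gradient f x) v - L * ‖v‖ ^ 2 * t) t := by
    intro t
    have h1 := ((aux_line_deriv f hfdiff x v t).sub
      ((hasDerivAt_id t).mul_const (inner ℝ (gradient f x) v))).sub
      ((hasDerivAt_pow 2 t).const_mul (L / 2 * ‖v‖ ^ 2))
    refine h1.congr_deriv ?_
    push_cast
    ring
  have ha := antitoneOn_of_deriv_nonpos (convex_Icc (0 : ℝ) 1)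
    (fun t _ => (hd t).continuousAt.continuousWithinAt)
    (fun t _ => (hd t).differentiableAt.differentiableWithinAt)
    (fun t ht => by
      rw [interior_Icc] at ht
      rw [(hd t).deriv, ← inner_sub_left]
      have h1 := real_inner_le_norm (gradient f (x + t • v) - gradient f x) v
      have h2 := hLip (x + t • v) x
      rw [add_sub_cancel_left, norm_smul, Real.norm_eq_abs, abs_of_pos ht.1] at h2
      nlinarith [mul_le_mul_of_nonneg_right h2 (norm_nonneg v)])
  have := ha (Set.left_mem_Icc.2 zero_le_one) (Set.right_mem_Icc.2 zero_le_one) zero_le_one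
  simp only [one_smul, zero_smul, add_zero] at this
  linarith

theorem aux_grad (f : E → ℝ) (hfdiff : Differentiable ℝ f) (L : ℝ) (hL : 0 < L)
    (hLip : ∀ y z, ‖gradient f y - gradient f z‖ ≤ L * ‖y - z‖)
    (hbdd : BddBelow (Set.range f)) (x : E) :
    ‖gradient f x‖ ^ 2 ≤ 2 * L * (f x - ⨅ y, f y) := by
  have h1 := aux_descent_s14 f hfdiff L hLip x (-(1 / L) • gradient f x)
  have h2 := ciInf_le hbdd (x + -(1 / L) • gradient f x)
  rw [inner_smul_right, real_inner_self_eq_norm_sq, norm_smul, mul_pow] at h1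
  simp only [norm_neg, Real.norm_eq_abs, sq_abs] at h1
  have h3 : f x + -(1 / L) * ‖gradient f x‖ ^ 2 + L / 2 * ((1 / L) ^ 2 * ‖gradient f x‖ ^ 2)
      = f x - ‖gradient f x‖ ^ 2 / (2 * L) := by
    field_simp
    ring
  have h4 : ‖gradient f x‖ ^ 2 / (2 * L) ≤ f x - ⨅ y, f y := by
    linarith
  rw [div_le_iff₀ (by positivity)] at h4
  linarith

theorem aux_proj_inner (C : Set E) (hCconv : Convex ℝ C) (projC : E → E)
    (hprojC : ∀ y, projC y ∈ C ∧ ∀ z ∈ C, ‖y - projC y‖ ≤ ‖y - z‖) (y z : E) (hz : z ∈ C) :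
    inner ℝ (y - projC y) (z - projC y) ≤ 0 := by
  refine (norm_eq_iInf_iff_real_inner_le_zero hCconv (hprojC y).1).1 ?_ z hz
  have : Nonempty C := ⟨⟨_, (hprojC y).1⟩⟩
  apply le_antisymm
  · exact le_ciInf fun w => (hprojC y).2 w w.2
  · exact ciInf_le (f := fun w : C => ‖y - w‖) ⟨0, by rintro _ ⟨w, rfl⟩; exact norm_nonneg _⟩
      ⟨_, (hprojC y).1⟩

theorem aux_nonexp (C : Set E) (hCconv : Convex ℝ C) (projC : E → E)
    (hprojC : ∀ y, projC y ∈ C ∧ ∀ z ∈ C, ‖y - projC y‖ ≤ ‖y - z‖) (y z : E) :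
    ‖projC y - projC z‖ ≤ ‖y - z‖ := by
  have h1 := aux_proj_inner C hCconv projC hprojC y (projC z) (hprojC z).1
  have h2 := aux_proj_inner C hCconv projC hprojC z (projC y) (hprojC y).1
  have h3 : inner ℝ (y - z) (projC y - projC z) - ‖projC y - projC z‖ ^ 2 =
      -inner ℝ (y - projC y) (projC z - projC y) - inner ℝ (z - projC z) (projC y - projC z) := by
    rw [← real_inner_self_eq_norm_sq]
    simp only [inner_sub_left, inner_sub_right]
    ring
  have h4 := real_inner_le_norm (y - z) (projC y - projC z)
  by_contra! hlt
  nlinarith [norm_nonneg (y - z)]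

theorem aux_dist (S : Set E) (projS : E → E)
    (hprojS : ∀ y, projS y ∈ S ∧ ∀ z ∈ S, ‖y - projS y‖ ≤ ‖y - z‖) (y : E) :
    ‖y - projS y‖ = Metric.infDist y S := by
  apply le_antisymm
  · rw [Metric.le_infDist ⟨_, (hprojS y).1⟩]
    intro z hz
    rw [dist_eq_norm]
    exact (hprojS y).2 z hz
  · rw [← dist_eq_norm]
    exact Metric.infDist_le_dist_of_mem (hprojS y).1

end helpers

/-- Iterated (multi-step) form of Theorem 2: the projected stochastic gradient
method with constant step-size, driven by i.i.d. samples, converges linearly to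
a noise-dominated region of squared radius `γ²σ₁²/ρ` around the solution set. -/
theorem stmt_14 {d : ℕ} {Ω₀ : Type*} [MeasurableSpace Ω₀] (ν : Measure Ω₀)
    [IsProbabilityMeasure ν]
    (C : Set (EuclideanSpace ℝ (Fin d))) (hCne : C.Nonempty) (hCclosed : IsClosed C)
    (hCconv : Convex ℝ C)
    (f : EuclideanSpace ℝ (Fin d) → ℝ) (hfconv : ConvexOn ℝ Set.univ f)
    (hfdiff : Differentiable ℝ f)
    (L : ℝ) (hL : 0 < L)
    (hLip : ∀ y z, ‖gradient f y - gradient f z‖ ≤ L * ‖y - z‖)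
    (hbdd : BddBelow (Set.range f))
    (S : Set (EuclideanSpace ℝ (Fin d)))
    (hS : S = {y | y ∈ C ∧ ∀ z ∈ C, f y ≤ f z}) (hSne : S.Nonempty)
    (projC : EuclideanSpace ℝ (Fin d) → EuclideanSpace ℝ (Fin d))
    (hprojC : ∀ y, projC y ∈ C ∧ ∀ z ∈ C, ‖y - projC y‖ ≤ ‖y - z‖)
    (projS : EuclideanSpace ℝ (Fin d) → EuclideanSpace ℝ (Fin d))
    (hprojS : ∀ y, projS y ∈ S ∧ ∀ z ∈ S, ‖y - projS y‖ ≤ ‖y - z‖)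
    (μ M σ : ℝ) (hM : 0 < M) (hμ : 0 < μ) (hμM : μ < 4 * L * M)
    (hrsc : ∀ y ∈ C, f y - f (projS y) ≥ μ / 2 * ‖y - projS y‖ ^ 2)
    (h : EuclideanSpace ℝ (Fin d) → Ω₀ → EuclideanSpace ℝ (Fin d))
    (hmeas : Measurable (Function.uncurry h))
    (hint : ∀ x ∈ C, Integrable (h x) ν)
    (hL2 : ∀ x ∈ C, Integrable (fun a => ‖h x a‖ ^ 2) ν)
    (hunbiased : ∀ x ∈ C, ∫ a, h x a ∂ν = gradient f x)
    (hwgc : ∀ x ∈ C, ∫ a, ‖h x a‖ ^ 2 ∂ν ≤ M * ‖gradient f x‖ ^ 2 + σ ^ 2)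
    (γ : ℝ) (hγ : 0 < γ) (hγle : γ ≤ 1 / (2 * L * M))
    (ρ : ℝ) (hρ : ρ = γ * μ * (1 - γ * L * M)) (hρmem : ρ ∈ Set.Ioo (0 : ℝ) 1)
    (s : EuclideanSpace ℝ (Fin d)) (hs : s ∈ S)
    (σ1sq : ℝ) (hσ1 : σ1sq = σ ^ 2 + 2 * L * M * (f s - ⨅ y, f y))
    (x₀ : EuclideanSpace ℝ (Fin d)) (hx₀ : x₀ ∈ C)
    (X : (t : ℕ) → (Fin t → Ω₀) → EuclideanSpace ℝ (Fin d))
    (hX0 : ∀ w, X 0 w = x₀)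
    (hXsucc : ∀ t (w : Fin (t + 1) → Ω₀),
      X (t + 1) w =
        projC (X t (fun i => w i.castSucc) -
            γ • h (X t (fun i => w i.castSucc)) (w (Fin.last t)))) :
    ∀ t, ∫ w, ‖X t w - projS (X t w)‖ ^ 2 ∂(Measure.pi fun _ : Fin t => ν) ≤
      (1 - ρ) ^ t * ‖x₀ - projS x₀‖ ^ 2 + γ ^ 2 * σ1sq / ρ := by
  obtain ⟨hρ0, hρ1⟩ := hρmem
  have hSC : S ⊆ C := by
    rw [hS]
    exact fun y hy => hy.1
  have hfS : ∀ y ∈ S, f y = f s := by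
    intro y hy
    have hy' := hy
    have hs' := hs
    rw [hS] at hy' hs'
    exact le_antisymm (hy'.2 s hs'.1) (hs'.2 y hy'.1)
  have hγLM : γ * L * M ≤ 1 / 2 := by
    rw [le_div_iff₀ (by positivity)] at hγle
    linarith
  have hinf : (⨅ y, f y) ≤ f s := ciInf_le hbdd s
  have hσ1nn : 0 ≤ σ1sq := by
    rw [hσ1]
    have : 0 ≤ f s - ⨅ y, f y := by linarith
    positivity
  have hnon := aux_nonexp C hCconv projC hprojC
  have hdist := aux_dist S projS hprojS
  have hcont : Continuous projC :=
    (LipschitzWith.of_dist_le_mul (K := 1) fun y z => by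
      simpa [dist_eq_norm] using hnon y z).continuous
  have hDmeas : Measurable fun y => ‖y - projS y‖ ^ 2 := by
    simp only [hdist]
    exact ((Metric.continuous_infDist_pt S).pow 2).measurable
  have hfix : ∀ p ∈ C, projC p = p := by
    intro p hp
    have := (hprojC p).2 p hp
    simp only [sub_self, norm_zero] at this
    exact (sub_eq_zero.1 (norm_le_zero_iff.1 this)).symm
  -- one step
  have hstep : ∀ x ∈ C, ∫⁻ a, ENNReal.ofReal (‖projC (x - γ • h x a) -
      projS (projC (x - γ • h x a))‖ ^ 2) ∂ν ≤
      ENNReal.ofReal ((1 - ρ) * ‖x - projS x‖ ^ 2 + γ ^ 2 * σ1sq) := by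
    intro x hx
    have hpS := (hprojS x).1
    have hpt : ∀ a, ‖projC (x - γ • h x a) - projS (projC (x - γ • h x a))‖ ^ 2 ≤
        ‖x - projS x‖ ^ 2 - 2 * γ * inner ℝ (x - projS x) (h x a) + γ ^ 2 * ‖h x a‖ ^ 2 := by
      intro a
      have h1 := (hprojS (projC (x - γ • h x a))).2 _ hpS
      have h2 := hnon (x - γ • h x a) (projS x)
      rw [hfix _ (hSC hpS)] at h2
      have h3 : ‖x - γ • h x a - projS x‖ ^ 2 = ‖x - projS x‖ ^ 2 -
          2 * γ * inner ℝ (x - projS x) (h x a) + γ ^ 2 * ‖h x a‖ ^ 2 := by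
        rw [sub_right_comm, norm_sub_sq_real, inner_smul_right, norm_smul, mul_pow,
          Real.norm_eq_abs, sq_abs]
        ring
      rw [← h3]
      exact pow_le_pow_left₀ (norm_nonneg _) (h1.trans h2) 2
    have hi1 : Integrable (fun a => inner ℝ (x - projS x) (h x a)) ν :=
      (hint x hx).const_inner _
    have hi2 : Integrable (fun a => ‖x - projS x‖ ^ 2 -
        2 * γ * inner ℝ (x - projS x) (h x a)) ν :=
      (integrable_const _).sub (hi1.const_mul _)
    have hi3 : Integrable (fun a => γ ^ 2 * ‖h x a‖ ^ 2) ν := (hL2 x hx).const_mul _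
    have hval : ∫ a, (‖x - projS x‖ ^ 2 - 2 * γ * inner ℝ (x - projS x) (h x a) +
        γ ^ 2 * ‖h x a‖ ^ 2) ∂ν = ‖x - projS x‖ ^ 2 -
        2 * γ * inner ℝ (x - projS x) (gradient f x) + γ ^ 2 * ∫ a, ‖h x a‖ ^ 2 ∂ν := by
      rw [integral_add hi2 hi3, integral_sub (integrable_const _) (hi1.const_mul _),
        integral_const_mul, integral_const_mul, integral_inner (hint x hx), hunbiased x hx]
      simp
    calc _ ≤ ∫⁻ a, ENNReal.ofReal (‖x - projS x‖ ^ 2 -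
          2 * γ * inner ℝ (x - projS x) (h x a) + γ ^ 2 * ‖h x a‖ ^ 2) ∂ν :=
          lintegral_mono fun a => ENNReal.ofReal_le_ofReal (hpt a)
      _ = ENNReal.ofReal (∫ a, (‖x - projS x‖ ^ 2 -
          2 * γ * inner ℝ (x - projS x) (h x a) + γ ^ 2 * ‖h x a‖ ^ 2) ∂ν) :=
          (ofReal_integral_eq_lintegral_ofReal (hi2.add hi3)
            (Filter.Eventually.of_forall fun a => (sq_nonneg _).trans (hpt a))).symm
      _ ≤ _ := by
        apply ENNReal.ofReal_le_ofReal
        rw [hval, real_inner_comm]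
        have g1 := aux_convex f hfconv hfdiff x (projS x)
        have g2 := aux_grad f hfdiff L hL hLip hbdd x
        have g3 := hwgc x hx
        have g4 := hrsc x hx
        rw [hfS _ hpS] at g1 g4
        have e1 := mul_le_mul_of_nonneg_left g1 (by positivity : 0 ≤ 2 * γ)
        have e2 := mul_le_mul_of_nonneg_left g2 (by positivity : 0 ≤ γ ^ 2 * M)
        have e3 := mul_le_mul_of_nonneg_left g3 (by positivity : 0 ≤ γ ^ 2)
        have e4 := mul_le_mul_of_nonneg_left g4
          (mul_nonneg (by positivity) (by linarith) : 0 ≤ 2 * γ * (1 - γ * L * M))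
        rw [hρ, hσ1]
        linarith
  -- membership and measurability of the iterates
  have hXC : ∀ t w, X t w ∈ C := by
    intro t
    cases t with
    | zero => intro w; rw [hX0]; exact hx₀
    | succ t => intro w; rw [hXsucc]; exact (hprojC _).1
  have hXmeas : ∀ t, Measurable (X t) := by
    intro t
    induction t with
    | zero =>
      have : X 0 = fun _ => x₀ := funext hX0
      rw [this]
      exact measurable_const
    | succ t ih =>
      rw [funext (hXsucc t)]
      have h1 : Measurable fun w : Fin (t + 1) → Ω₀ => X t (fun i => w i.castSucc) :=
        ih.comp (measurable_pi_lambda _ fun i => measurable_pi_apply _)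
      have h2 : Measurable fun w : Fin (t + 1) → Ω₀ =>
          h (X t (fun i => w i.castSucc)) (w (Fin.last t)) :=
        hmeas.comp (h1.prodMk (measurable_pi_apply _))
      exact hcont.measurable.comp (h1.sub (h2.const_smul γ))
  have hmain : ∀ t, ∫⁻ w, ENNReal.ofReal (‖X t w - projS (X t w)‖ ^ 2)
      ∂(Measure.pi fun _ : Fin t => ν) ≤
      ENNReal.ofReal ((1 - ρ) ^ t * ‖x₀ - projS x₀‖ ^ 2 + γ ^ 2 * σ1sq / ρ) := by
    intro t
    induction t with
    | zero =>
      simp only [hX0, lintegral_const, measure_univ, mul_one, pow_zero, one_mul]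
      apply ENNReal.ofReal_le_ofReal
      have : 0 ≤ γ ^ 2 * σ1sq / ρ := by positivity
      linarith
    | succ t ih =>
      have hmp := (measurePreserving_piFinSuccAbove (fun _ : Fin (t + 1) => ν) (Fin.last t)).symm
      have hFm : Measurable fun w : Fin (t + 1) → Ω₀ =>
          ENNReal.ofReal (‖X (t + 1) w - projS (X (t + 1) w)‖ ^ 2) :=
        (hDmeas.comp (hXmeas (t + 1))).ennreal_ofReal
      rw [← hmp.lintegral_comp hFm, lintegral_prod_symm]
      swap
      · exact (hFm.comp hmp.measurable).aemeasurable
      have hρ1' : 0 ≤ 1 - ρ := by linarith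
      calc _ ≤ ∫⁻ w, ENNReal.ofReal ((1 - ρ) * ‖X t w - projS (X t w)‖ ^ 2 + γ ^ 2 * σ1sq)
            ∂(Measure.pi fun _ : Fin t => ν) := by
            apply lintegral_mono
            intro w
            refine le_trans (le_of_eq ?_) (hstep (X t w) (hXC t w))
            apply lintegral_congr
            intro a
            simp [hXsucc, MeasurableEquiv.piFinSuccAbove]
        _ = ∫⁻ w, (ENNReal.ofReal (1 - ρ) * ENNReal.ofReal (‖X t w - projS (X t w)‖ ^ 2) +
            ENNReal.ofReal (γ ^ 2 * σ1sq)) ∂(Measure.pi fun _ : Fin t => ν) := by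
            apply lintegral_congr
            intro w
            rw [ENNReal.ofReal_add (by positivity) (by positivity), ENNReal.ofReal_mul hρ1']
        _ = ENNReal.ofReal (1 - ρ) * ∫⁻ w, ENNReal.ofReal (‖X t w - projS (X t w)‖ ^ 2)
            ∂(Measure.pi fun _ : Fin t => ν) + ENNReal.ofReal (γ ^ 2 * σ1sq) := by
            rw [lintegral_add_right _ measurable_const,
              lintegral_const_mul' _ _ ENNReal.ofReal_ne_top]
            simp
        _ ≤ ENNReal.ofReal (1 - ρ) * ENNReal.ofReal ((1 - ρ) ^ t * ‖x₀ - projS x₀‖ ^ 2 +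
            γ ^ 2 * σ1sq / ρ) + ENNReal.ofReal (γ ^ 2 * σ1sq) := by gcongr
        _ = _ := by
            rw [← ENNReal.ofReal_mul hρ1', ← ENNReal.ofReal_add (by positivity) (by positivity)]
            congr 1
            field_simp
            ring
  intro t
  rw [integral_eq_lintegral_of_nonneg_ae (Filter.Eventually.of_forall fun w => sq_nonneg _)
    (hDmeas.comp (hXmeas t)).aestronglyMeasurable]
  refine ENNReal.toReal_le_of_le_ofReal ?_ (hmain t)
  have hρ1' : 0 ≤ 1 - ρ := by linarith
  positivity
end
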